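/- Continuous analogues of the path-transformation identities: let k≥2 and let f=(f_1,…,f_k):[0,∞)→ℝ^k be continuous with f(0)=0. Then (i) for every t≥0, ∑_{i=1}^k (Γ^{(k)}(f))_i(t) = ∑_{i=1}^k f_i(t); and (ii) the top coordinate of the transformed path satisfies (Γ^{(k)}(f))_k = f_k⊔f_{k−1}⊔⋯⊔f_1 (evaluated left to right). -/

import Mathlib

noncomputable def cminOp (f g : ℝ → ℝ) : ℝ → ℝ := fun t =>
  sInf ((fun s => f s + g t - g s) '' Set.Icc 0 t)

noncomputable def cmaxOp (f g : ℝ → ℝ) : ℝ → ℝ := fun t =>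
  sSup ((fun s => f s + g t - g s) '' Set.Icc 0 t)

/-- `cDseq f i = f 0 ⊓ f 1 ⊓ ⋯ ⊓ f i` (left to right). -/
noncomputable def cDseq (f : ℕ → ℝ → ℝ) : ℕ → (ℝ → ℝ)
  | 0 => f 0
  | i+1 => cminOp (cDseq f i) (f (i+1))

/-- `cTseq f i = f (i+1) ⊔ (f 0 ⊓ ⋯ ⊓ f i)`. -/
noncomputable def cTseq (f : ℕ → ℝ → ℝ) : ℕ → (ℝ → ℝ) :=
  fun i => cmaxOp (f (i+1)) (cDseq f i)

/-- The continuous path transformation `Γ^{(k)}` (coordinates `0,…,k-1`). -/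
noncomputable def Gamma : ℕ → (ℕ → ℝ → ℝ) → (ℕ → ℝ → ℝ)
  | 0, f => f
  | 1, f => f
  | (k+2), f => fun i => match i with
      | 0 => cDseq f (k+1)
      | (j+1) => Gamma (k+1) (cTseq f) j

/-- `cChainMax y j = y 0 ⊔ y 1 ⊔ ⋯ ⊔ y j` (left to right). -/
noncomputable def cChainMax (y : ℕ → ℝ → ℝ) : ℕ → (ℝ → ℝ)
  | 0 => y 0
  | j+1 => cmaxOp (cChainMax y j) (y (j+1))

def CC (f : ℝ → ℝ) : Prop := ContinuousOn f (Set.Ici 0)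

noncomputable def rmax (d : ℝ → ℝ) (t : ℝ) : ℝ := sSup (d '' Set.Icc 0 t)

lemma CC.bdd {d : ℝ → ℝ} (hd : CC d) (t : ℝ) : BddAbove (d '' Set.Icc 0 t) :=
  (isCompact_Icc.image_of_continuousOn (hd.mono (fun _ hx => hx.1))).bddAbove

lemma CC.le_rmax {d : ℝ → ℝ} (hd : CC d) {s t : ℝ} (hs : 0 ≤ s) (hst : s ≤ t) :
    d s ≤ rmax d t := le_csSup (hd.bdd t) ⟨s, ⟨hs, hst⟩, rfl⟩

lemma rmax_le {d : ℝ → ℝ} {t x : ℝ} (ht : 0 ≤ t)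
    (h : ∀ s, 0 ≤ s → s ≤ t → d s ≤ x) : rmax d t ≤ x := by
  apply csSup_le ((Set.nonempty_Icc.2 ht).image d)
  rintro _ ⟨s, hs, rfl⟩
  exact h s hs.1 hs.2

lemma CC.rmax_mono {d : ℝ → ℝ} (hd : CC d) {s t : ℝ} (hs : 0 ≤ s) (hst : s ≤ t) :
    rmax d s ≤ rmax d t := rmax_le hs (fun _ h1 h2 => hd.le_rmax h1 (h2.trans hst))

lemma CC.rmax_cont {d : ℝ → ℝ} (hd : CC d) : CC (rmax d) := by
  have hc : Continuous (fun x : ℝ => d (max 0 x)) :=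
    hd.comp_continuous (by fun_prop) (fun x => Set.mem_Ici.2 (le_max_left _ _))
  have h1 : Continuous (fun t : ℝ => sSup ((fun u : ℝ => d (max 0 (t * u))) '' Set.Icc 0 1)) := by
    apply IsCompact.continuous_sSup isCompact_Icc
    exact hc.comp (continuous_fst.mul continuous_snd)
  refine h1.continuousOn.congr ?_
  intro t ht
  have ht : (0:ℝ) ≤ t := ht
  unfold rmax
  simp only
  congr 1
  ext y
  constructor
  · rintro ⟨s, ⟨h0, h1⟩, rfl⟩
    rcases ht.eq_or_lt with rfl | ht'
    · refine ⟨0, by simp, ?_⟩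
      have : s = 0 := le_antisymm h1 h0
      simp [this]
    · refine ⟨s / t, ⟨by positivity, (div_le_one ht').2 h1⟩, ?_⟩
      have : t * (s / t) = s := by field_simp
      simp only [this, max_eq_right h0]
  · rintro ⟨u, ⟨h0, h1⟩, rfl⟩
    have : 0 ≤ t * u := by positivity
    refine ⟨t * u, ⟨this, by nlinarith⟩, ?_⟩
    simp only [max_eq_right this]

lemma max_le_iff' {f g : ℝ → ℝ} (hf : CC f) (hg : CC g) {t x : ℝ} (ht : 0 ≤ t) :
    cmaxOp f g t ≤ x ↔ ∀ s, 0 ≤ s → s ≤ t → f s + g t - g s ≤ x := by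
  have hc : CC (fun s => f s + g t - g s) := (hf.add continuousOn_const).sub hg
  constructor
  · intro h s hs hst
    exact (hc.le_rmax hs hst).trans h
  · intro h
    exact rmax_le (d := fun s => f s + g t - g s) ht h

lemma cmax_eq {f g : ℝ → ℝ} (hf : CC f) (hg : CC g) {t : ℝ} (ht : 0 ≤ t) :
    cmaxOp f g t = g t + rmax (f - g) t := by
  have hc : CC (f - g) := hf.sub hg
  apply eq_of_forall_ge_iff
  intro x
  rw [max_le_iff' hf hg ht]
  constructor
  · intro h
    have : rmax (f - g) t ≤ x - g t := rmax_le ht (fun s h1 h2 => by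
      have := h s h1 h2
      simp only [Pi.sub_apply]; linarith)
    linarith
  · intro h s h1 h2
    have := hc.le_rmax h1 h2
    simp only [Pi.sub_apply] at this; linarith

lemma cmin_eq {f g : ℝ → ℝ} (hf : CC f) (hg : CC g) {t : ℝ} (ht : 0 ≤ t) :
    cminOp f g t = g t - rmax (g - f) t := by
  have hh : cminOp f g t = - cmaxOp (-f) (-g) t := by
    unfold cminOp cmaxOp
    rw [Real.sInf_def]
    congr 2
    ext y
    simp only [Set.mem_neg, Set.mem_image, Pi.neg_apply]
    constructor
    · rintro ⟨s, hs, h⟩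
      exact ⟨s, hs, by linarith⟩
    · rintro ⟨s, hs, h⟩
      exact ⟨s, hs, by linarith⟩
  rw [hh, cmax_eq hf.neg hg.neg ht]
  have : -f - -g = g - f := by ring
  rw [this, Pi.neg_apply]; ring

lemma CC.cmax {f g : ℝ → ℝ} (hf : CC f) (hg : CC g) : CC (cmaxOp f g) :=
  (hg.add (CC.rmax_cont (hf.sub hg))).congr (fun _ ht => cmax_eq hf hg ht)

lemma CC.cmin {f g : ℝ → ℝ} (hf : CC f) (hg : CC g) : CC (cminOp f g) :=
  (hg.sub (CC.rmax_cont (hg.sub hf))).congr (fun _ ht => cmin_eq hf hg ht)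

lemma sum2 {f g : ℝ → ℝ} (hf : CC f) (hg : CC g) {t : ℝ} (ht : 0 ≤ t) :
    cminOp f g t + cmaxOp g f t = f t + g t := by
  rw [cmin_eq hf hg ht, cmax_eq hg hf ht]; ring

lemma exists_hit {d : ℝ → ℝ} (hd : CC d) {r t : ℝ} (hr : 0 ≤ r) (hrt : r ≤ t)
    (h : rmax d r < rmax d t) :
    ∃ s, r ≤ s ∧ s ≤ t ∧ d s = rmax d r ∧ rmax d s = rmax d r := by
  have ht := hr.trans hrt
  obtain ⟨q, hq0, hqt, hq⟩ : ∃ q, 0 ≤ q ∧ q ≤ t ∧ rmax d r < d q := by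
    by_contra! hcon
    exact absurd (rmax_le ht hcon) (not_le.2 h)
  have hrq : r ≤ q := by
    by_contra! hlt
    exact absurd (hd.le_rmax hq0 hlt.le) (not_le.2 hq)
  have hcont : ContinuousOn d (Set.Icc r t) := hd.mono (fun x hx => hr.trans hx.1)
  have hcpt : IsCompact (Set.Icc r t ∩ d ⁻¹' Set.Ici (rmax d r)) :=
    isCompact_Icc.of_isClosed_subset
      (hcont.preimage_isClosed_of_isClosed isClosed_Icc isClosed_Ici) Set.inter_subset_left
  obtain ⟨s, ⟨⟨hs1, hs2⟩, hs3⟩, hmin⟩ := hcpt.exists_isLeast ⟨q, ⟨hrq, hqt⟩, hq.le⟩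
  have hs3 : rmax d r ≤ d s := hs3
  have hds : d s = rmax d r := by
    obtain ⟨x, ⟨hx1, hx2⟩, hx⟩ := intermediate_value_Icc hs1
      (hcont.mono (Set.Icc_subset_Icc_right hs2)) ⟨hd.le_rmax hr le_rfl, hs3⟩
    have := hmin (show x ∈ Set.Icc r t ∩ d ⁻¹' Set.Ici (rmax d r) from
      ⟨⟨hx1, hx2.trans hs2⟩, hx.ge⟩)
    rw [← hx, le_antisymm hx2 this]
  refine ⟨s, hs1, hs2, hds, le_antisymm (rmax_le (hr.trans hs1) ?_) (hd.rmax_mono hr hs1)⟩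
  intro x hx0 hxs
  rcases le_total x r with hxr | hxr
  · exact hd.le_rmax hx0 hxr
  · by_contra! hlt
    have := hmin (show x ∈ Set.Icc r t ∩ d ⁻¹' Set.Ici (rmax d r) from
      ⟨⟨hxr, hxs.trans hs2⟩, hlt.le⟩)
    have : x = s := le_antisymm hxs this
    rw [this, hds] at hlt
    exact lt_irrefl _ hlt

lemma key {h f g : ℝ → ℝ} (hh : CC h) (hf : CC f) (hg : CC g) {t : ℝ} (ht : 0 ≤ t) :
    cmaxOp (cmaxOp h (cminOp f g)) (cmaxOp g f) t = cmaxOp (cmaxOp h g) f t := by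
  have hu := hf.cmin hg
  have hv := hg.cmax hf
  have hd : CC (g - f) := hg.sub hf
  have eu : ∀ s, 0 ≤ s → cminOp f g s = g s - rmax (g - f) s := fun s hs => cmin_eq hf hg hs
  have ev : ∀ s, 0 ≤ s → cmaxOp g f s = f s + rmax (g - f) s := fun s hs => cmax_eq hg hf hs
  have unf : ∀ a b : ℝ → ℝ, CC a → CC b → ∀ x, cmaxOp (cmaxOp h a) b t ≤ x ↔
      ∀ r s, 0 ≤ r → r ≤ s → s ≤ t → h r + a s - a r + b t - b s ≤ x := by
    intro a b ha hb x
    rw [max_le_iff' (hh.cmax ha) hb ht]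
    constructor
    · intro H r s hr hrs hst
      have hs := hr.trans hrs
      have h1 := H s hs hst
      have h2 : cmaxOp h a s ≤ x - b t + b s := by linarith
      have h3 := (max_le_iff' hh ha hs).1 h2 r hr hrs
      linarith
    · intro H s hs hst
      have : cmaxOp h a s ≤ x - b t + b s := (max_le_iff' hh ha hs).2 (fun r hr hrs => by
        have := H r s hr hrs hst
        linarith)
      linarith
  have hA : ∀ s, (g - f) s = g s - f s := fun s => rfl
  apply eq_of_forall_ge_iff
  intro x
  rw [unf _ _ hu hv, unf _ _ hg hf]
  constructor
  · intro H r s hr hrs hst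
    have hs := hr.trans hrs
    have hrt := hrs.trans hst
    rcases (hd.rmax_mono hr hrt).eq_or_lt with heq | hlt
    · have h1 := H r s hr hrs hst
      rw [eu _ hs, eu _ hr, ev _ hs, ev _ ht] at h1
      have h2 := hd.rmax_mono hr hrs
      have h3 := hd.rmax_mono hs hst
      linarith
    · obtain ⟨q, hq1, hq2, hq3, hq4⟩ := exists_hit hd hr hrt hlt
      have hq := hr.trans hq1
      have h1 := H r q hr hq1 hq2
      rw [eu _ hq, eu _ hr, ev _ hq, ev _ ht] at h1
      have h2 := hd.le_rmax hs hst
      rw [hA] at hq3 h2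
      linarith
  · intro H r s hr hrs hst
    have hs := hr.trans hrs
    have hrt := hrs.trans hst
    rw [eu _ hs, eu _ hr, ev _ hs, ev _ ht]
    have h2 := hd.rmax_mono hr hrs
    have h3 := hd.rmax_mono hs hst
    have h4 := hd.le_rmax hs le_rfl
    rw [hA] at h4
    rcases (hd.rmax_mono hr hrt).eq_or_lt with heq | hlt
    · have h1 := H r s hr hrs hst
      linarith
    · have : rmax (g - f) t ≤ x - h r + g r - f t := by
        by_contra! hcon
        have hmax : max (x - h r + g r - f t) (rmax (g - f) r) < rmax (g - f) t := max_lt hcon hlt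
        refine absurd (rmax_le ht ?_) (not_le.2 hmax)
        intro q hq hqt
        rcases le_total q r with hqr | hqr
        · exact (hd.le_rmax hq hqr).trans (le_max_right _ _)
        · refine le_trans ?_ (le_max_left _ _)
          have := H r q hr hqr hqt
          rw [hA]; linarith
      linarith

lemma cmax_congr {f f' g g' : ℝ → ℝ} (hf : Set.EqOn f f' (Set.Ici 0))
    (hg : Set.EqOn g g' (Set.Ici 0)) : Set.EqOn (cmaxOp f g) (cmaxOp f' g') (Set.Ici 0) := by
  intro t ht
  unfold cmaxOp
  congr 1
  apply Set.image_congr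
  intro s hs
  rw [hf hs.1, hg hs.1, hg ht]

noncomputable def RR (h : ℝ → ℝ) (f : ℕ → ℝ → ℝ) : ℕ → ℝ → ℝ
  | 0 => h
  | m+1 => RR (cmaxOp h (f m)) f m
termination_by structural m => m

lemma RR_congr (f : ℕ → ℝ → ℝ) (m : ℕ) : ∀ h h' : ℝ → ℝ, Set.EqOn h h' (Set.Ici 0) →
    Set.EqOn (RR h f m) (RR h' f m) (Set.Ici 0) := by
  induction m with
  | zero => intro h h' e; exact e
  | succ m ih => intro h h' e; exact ih _ _ (cmax_congr e (fun _ _ => rfl))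

lemma RR_chain (y f : ℕ → ℝ → ℝ) (m : ℕ) : ∀ j, (∀ i, i < m → y (j + 1 + i) = f (m - 1 - i)) →
    RR (cChainMax y j) f m = cChainMax y (j + m) := by
  induction m with
  | zero => intro j _; rfl
  | succ m ih =>
    intro j hy
    have h0 := hy 0 (by omega)
    have e : cmaxOp (cChainMax y j) (f m) = cChainMax y (j + 1) := by
      have h0' : y (j + 1) = f m := by simpa using h0
      rw [← h0']; rfl
    change RR (cmaxOp (cChainMax y j) (f m)) f m = _
    rw [e, ih (j + 1)]
    · congr 1; omega
    · intro i hi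
      have := hy (i + 1) (by omega)
      rw [show j + 1 + 1 + i = j + 1 + (i + 1) by omega, this]
      congr 1; omega

lemma D_cont (f : ℕ → ℝ → ℝ) (m : ℕ) (hf : ∀ i, i ≤ m → CC (f i)) : CC (cDseq f m) := by
  induction m with
  | zero => exact hf 0 le_rfl
  | succ m ih => exact (ih (fun i hi => hf i (by omega))).cmin (hf _ le_rfl)

lemma T_cont (f : ℕ → ℝ → ℝ) (n : ℕ) (hf : ∀ i, i < n + 1 → CC (f i)) :
    ∀ i, i < n → CC (cTseq f i) := fun i hi =>
  (hf (i + 1) (by omega)).cmax (D_cont f i (fun j hj => hf j (by omega)))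

lemma T_chain (f : ℕ → ℝ → ℝ) (m : ℕ) : ∀ h : ℝ → ℝ, CC h → (∀ i, i ≤ m → CC (f i)) →
    Set.EqOn (RR (cmaxOp h (cDseq f m)) (cTseq f) m) (RR h f (m + 1)) (Set.Ici 0) := by
  induction m with
  | zero => intro h _ _ t _; rfl
  | succ m ih =>
    intro h hh hf
    have h1 := ih (cmaxOp h (f (m + 1))) (hh.cmax (hf _ le_rfl)) (fun i hi => hf i (by omega))
    refine Set.EqOn.trans ?_ h1
    refine RR_congr (cTseq f) m (cmaxOp (cmaxOp h (cDseq f (m + 1))) (cTseq f m)) _ ?_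
    intro t ht
    exact key hh (D_cont f m (fun i hi => hf i (by omega))) (hf _ le_rfl) ht

lemma T_sum (f : ℕ → ℝ → ℝ) (n : ℕ) (hf : ∀ i, i ≤ n → CC (f i)) {t : ℝ} (ht : 0 ≤ t) :
    ∑ i ∈ Finset.range n, cTseq f i t + cDseq f n t = ∑ i ∈ Finset.range (n + 1), f i t := by
  induction n with
  | zero => simp [cDseq]
  | succ n ih =>
    have h1 := ih (fun i hi => hf i (by omega))
    have h2 := sum2 (D_cont f n (fun i hi => hf i (by omega))) (hf (n + 1) le_rfl) ht
    rw [Finset.sum_range_succ, Finset.sum_range_succ _ (n + 1), ← h1]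
    change _ + cmaxOp (f (n + 1)) (cDseq f n) t + cminOp (cDseq f n) (f (n + 1)) t = _
    linarith

lemma G_sum (n : ℕ) : ∀ f : ℕ → ℝ → ℝ, (∀ i, i < n + 1 → CC (f i)) → ∀ t : ℝ, 0 ≤ t →
    ∑ i ∈ Finset.range (n + 1), Gamma (n + 1) f i t = ∑ i ∈ Finset.range (n + 1), f i t := by
  induction n with
  | zero => intro f _ t _; rfl
  | succ n ih =>
    intro f hf t ht
    rw [Finset.sum_range_succ']
    have h1 := ih (cTseq f) (T_cont f _ hf) t ht
    have h2 := T_sum f (n + 1) (fun i hi => hf i (by omega)) ht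
    rw [← h2, ← h1]
    rfl

lemma G_top (n : ℕ) : ∀ f : ℕ → ℝ → ℝ, (∀ i, i < n + 1 → CC (f i)) →
    Set.EqOn (Gamma (n + 1) f n) (RR (f n) f n) (Set.Ici 0) := by
  induction n with
  | zero => intro f _ t _; rfl
  | succ n ih =>
    intro f hf
    have h1 := ih (cTseq f) (T_cont f _ hf)
    have h2 := T_chain f n (f (n + 1)) (hf _ (by omega)) (fun i hi => hf i (by omega))
    exact h1.trans h2

theorem stmt19 (k : ℕ) (hk : 2 ≤ k) (f : ℕ → ℝ → ℝ)
    (hcont : ∀ i, i < k → ContinuousOn (f i) (Set.Ici 0))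
    (h0 : ∀ i, i < k → f i 0 = 0) :
    (∀ t : ℝ, 0 ≤ t →
      ∑ i ∈ Finset.range k, Gamma k f i t = ∑ i ∈ Finset.range k, f i t) ∧
    (∀ t : ℝ, 0 ≤ t →
      Gamma k f (k-1) t = cChainMax (fun i => f (k-1-i)) (k-1) t) := by
  obtain ⟨n, rfl⟩ : ∃ n, k = n + 1 := ⟨k - 1, by omega⟩
  refine ⟨G_sum n f hcont, ?_⟩
  intro t ht
  simp only [Nat.add_sub_cancel]
  have h1 := RR_chain (fun i => f (n - i)) f n 0 (fun i hi => by
    congr 1; omega)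
  have h2 := G_top n f hcont ht
  rw [h2]
  simp only [Nat.zero_add] at h1
  rw [← h1]
  rfl
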